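/- For γ₀ > 0, ω₀ > 0, ω_c ∈ ℝ and ν > 0, the contour integral identity (1/π) ∫_{-∞}^{∞} [ω/(ω² + ν²)] · Re[i/(ω² − ω₀² − ωω_c + iγ₀ω)] · ω dω = Re[1/(ν² + ω₀² + iνω_c + γ₀ν)] holds; in real form, (ω₀²/π) ∫_{-∞}^{∞} [ω²/(ω² + ν²)] Φ(ω) dω = ω₀²(ν² + ω₀² + γ₀ν)/[(ν² + ω₀² + γ₀ν)² + (νω_c)²], where Φ(ω) = γ₀/[(ω² − ω₀² − ωω_c)² + (γ₀ω)²]. -/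

import Mathlib

open Real MeasureTheory

open Complex in
/-- The quadratic `z² - w₀² - c z + iγz` has no zeros on the closed upper half-plane,
in homogeneous coordinates `[u : v]`. -/
lemma eq_zero_of_damped_quadratic_eq_zero {γ w₀ c : ℝ} (hγ : 0 < γ) (hw₀ : 0 < w₀) {u v : ℂ}
    (him : 0 ≤ u.im * v.re - u.re * v.im)
    (h : u ^ 2 - w₀ ^ 2 * v ^ 2 - (c - γ * I) * (u * v) = 0) : u = 0 ∧ v = 0 := by
  obtain ⟨a, b⟩ := u
  obtain ⟨p, q⟩ := v
  simp only at him
  have hre := congrArg Complex.re h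
  have hi := congrArg Complex.im h
  simp [pow_two] at hre hi
  have key : (a ^ 2 + b ^ 2 + w₀ ^ 2 * (p ^ 2 + q ^ 2)) * (b * p - a * q)
      + γ * ((a ^ 2 + b ^ 2) * (p ^ 2 + q ^ 2)) = 0 := by
    linear_combination (a * p - b * q) * hi - (a * q + b * p) * hre
  have hprod : (a ^ 2 + b ^ 2) * (p ^ 2 + q ^ 2) = 0 := by
    have h1 : 0 ≤ (a ^ 2 + b ^ 2 + w₀ ^ 2 * (p ^ 2 + q ^ 2)) * (b * p - a * q) :=
      mul_nonneg (by positivity) him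
    have h2 : 0 ≤ (a ^ 2 + b ^ 2) * (p ^ 2 + q ^ 2) := by positivity
    nlinarith
  have huv : (⟨a, b⟩ : ℂ) * ⟨p, q⟩ = 0 := by
    rw [← normSq_eq_zero, normSq_mul, normSq_mk, normSq_mk]
    linear_combination hprod
  have hw : (w₀ : ℂ) ≠ 0 := by exact_mod_cast hw₀.ne'
  rcases mul_eq_zero.1 huv with h0 | h0 <;> simp [h0, hw] at h ⊢ <;> exact h

open Complex in
/-- The mean value property on the unit circle, in the half-angle parametrization. -/
lemma integral_im_exp_two_mul {G : ℂ → ℂ} (hG : DiffContOnCl ℂ G (Metric.ball 0 1)) :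
    ∫ t in -(π / 2)..π / 2, (G (exp ((2 * t : ℝ) * I))).im = π * (G 0).im := by
  have hcont : Continuous fun θ : ℝ ↦ G (exp (θ * I)) := by
    have hc : ContinuousOn G (Metric.closedBall 0 1) := by
      simpa [closure_ball] using hG.continuousOn
    refine hc.comp_continuous (by fun_prop) fun θ ↦ ?_
    simp [norm_exp_ofReal_mul_I]
  have hper : Function.Periodic (fun θ : ℝ ↦ (G (exp (θ * I))).im) (2 * π) := fun θ ↦ by
    have := exp_periodic (θ * I)
    simp only
    rw [← this]
    push_cast
    ring_nf
  have hmean : ∫ θ in (0 : ℝ)..2 * π, G (exp (θ * I)) = 2 * π * G 0 := by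
    have h := DiffContOnCl.circleAverage (c := 0) (R := 1) (f := G) (by simpa using hG)
    rw [circleAverage_def] at h
    simp only [circleMap, ofReal_one, one_mul, zero_add] at h
    rw [← h, real_smul]
    have : (π : ℂ) ≠ 0 := by exact_mod_cast pi_ne_zero
    push_cast
    rw [← mul_assoc, mul_inv_cancel₀ (by simp [this]), one_mul]
  have him : ∫ θ in (0 : ℝ)..2 * π, (G (exp (θ * I))).im = 2 * π * (G 0).im := by
    have h := imCLM.intervalIntegral_comp_comm (hcont.intervalIntegrable (μ := volume) 0 (2 * π))
    simp only [imCLM_apply] at h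
    rw [h, hmean]
    simp
  have h2 := intervalIntegral.integral_comp_mul_left (a := -(π / 2)) (b := π / 2)
    (fun θ : ℝ ↦ (G (exp (θ * I))).im) (two_ne_zero (α := ℝ))
  have h3 := hper.intervalIntegral_add_eq (-π) 0
  rw [h2, show 2 * -(π / 2) = -π by ring, show 2 * (π / 2) = -π + 2 * π by ring, h3, zero_add, him,
    smul_eq_mul]
  ring

/-- The substitution `ω = ν tan t` on the real line. -/
lemma integral_eq_integral_mul_tan {ν : ℝ} (hν : 0 < ν) (f : ℝ → ℝ) :
    ∫ ω : ℝ, f ω = ∫ t in -(π / 2)..π / 2, ν / cos t ^ 2 * f (ν * tan t) := by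
  have himage : (fun t ↦ ν * tan t) '' Set.Ioo (-(π / 2)) (π / 2) = Set.univ := by
    refine Set.eq_univ_of_forall fun x ↦ ⟨arctan (x / ν), arctan_mem_Ioo _, ?_⟩
    simp only [tan_arctan]
    field_simp
  have hinj : Set.InjOn (fun t ↦ ν * tan t) (Set.Ioo (-(π / 2)) (π / 2)) := fun x hx y hy h ↦
    injOn_tan hx hy (mul_left_cancel₀ hν.ne' h)
  have h := integral_image_eq_integral_abs_deriv_smul measurableSet_Ioo
    (fun t ht ↦ ((hasDerivAt_tan_of_mem_Ioo ht).const_mul ν).hasDerivWithinAt) hinj f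
  rw [himage, setIntegral_univ] at h
  rw [h, intervalIntegral.integral_of_le (by linarith [pi_pos]), integral_Ioc_eq_integral_Ioo]
  refine setIntegral_congr_fun measurableSet_Ioo fun t _ ↦ ?_
  simp only [smul_eq_mul]
  rw [abs_of_nonneg (by positivity), mul_one_div]

open Complex in
/-- The response function `z / (z² - w₀² - c z + iγz)` pulled back to the unit disc by
the Cayley transform `z = iν(1 - w)/(1 + w)`. -/
noncomputable def discResponse (γ w₀ c ν : ℝ) (w : ℂ) : ℂ :=
  (ν * I * (1 - w)) * (1 + w) / ((ν * I * (1 - w)) ^ 2 - w₀ ^ 2 * (1 + w) ^ 2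
    - (c - γ * I) * ((ν * I * (1 - w)) * (1 + w)))

open Complex in
lemma diffContOnCl_discResponse {γ w₀ ν : ℝ} (c : ℝ) (hγ : 0 < γ) (hw₀ : 0 < w₀) (hν : 0 < ν) :
    DiffContOnCl ℂ (discResponse γ w₀ c ν) (Metric.ball 0 1) := by
  refine DifferentiableOn.diffContOnCl fun w hw ↦ DifferentiableAt.differentiableWithinAt ?_
  rw [closure_ball _ one_ne_zero, mem_closedBall_zero_iff] at hw
  unfold discResponse
  refine DifferentiableAt.fun_div (by fun_prop) (by fun_prop) fun h ↦ ?_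
  have hsq : w.re ^ 2 + w.im ^ 2 ≤ 1 := by
    have := normSq_eq_norm_sq w
    rw [normSq_apply] at this
    nlinarith [norm_nonneg w]
  obtain ⟨hu, hv⟩ := eq_zero_of_damped_quadratic_eq_zero hγ hw₀ (by
    simp
    nlinarith) h
  have hne : (ν : ℂ) * I ≠ 0 := mul_ne_zero (by exact_mod_cast hν.ne') I_ne_zero
  have h1 := (mul_eq_zero.1 hu).resolve_left hne
  have : (2 : ℂ) = 0 := by linear_combination h1 + hv
  norm_num at this

open Complex in
lemma discResponse_zero_im {γ w₀ ν : ℝ} (c : ℝ) (hγ : 0 < γ) (hν : 0 < ν) :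
    (discResponse γ w₀ c ν 0).im = -(ν * (ν ^ 2 + w₀ ^ 2 + γ * ν)
      / ((ν ^ 2 + w₀ ^ 2 + γ * ν) ^ 2 + (ν * c) ^ 2)) := by
  have h : discResponse γ w₀ c ν 0
      = (ν * I) / (-((ν ^ 2 + w₀ ^ 2 + γ * ν : ℝ) : ℂ) + ((-(ν * c) : ℝ) : ℂ) * I) := by
    unfold discResponse
    push_cast
    congr 1
    · ring
    · linear_combination ((ν : ℂ) ^ 2 + γ * ν) * I_sq
  rw [h, div_im, normSq_apply]
  simp only [mul_re, mul_im, add_re, add_im, neg_re, neg_im, ofReal_re, ofReal_im, I_re, I_im]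
  have hpos : 0 < (ν ^ 2 + w₀ ^ 2 + γ * ν) ^ 2 + (ν * c) ^ 2 := by positivity
  have heq : ∀ A B : ℝ, 0 < A ^ 2 + B ^ 2 → ∀ C, C = A ^ 2 + B ^ 2 →
      ν * (-A) / C = -(ν * A / (A ^ 2 + B ^ 2)) := by
    rintro A B _ C rfl
    ring
  rw [← heq _ _ hpos _ rfl]
  ring_nf

open Complex in
lemma discResponse_exp_im {γ w₀ : ℝ} (c ν t : ℝ) :
    (discResponse γ w₀ c ν (exp ((2 * t : ℝ) * I))).im
      = -(γ * (ν * Real.sin t * Real.cos t) ^ 2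
        / (((ν * Real.sin t) ^ 2 - w₀ ^ 2 * Real.cos t ^ 2
          - c * (ν * Real.sin t * Real.cos t)) ^ 2 + (γ * (ν * Real.sin t * Real.cos t)) ^ 2)) := by
  set e := exp (t * I) with he
  have hexp : exp ((2 * t : ℝ) * I) = e ^ 2 := by
    rw [he, ← Complex.exp_nat_mul]
    push_cast
    ring_nf
  have hee : e = Real.cos t + Real.sin t * I := by
    rw [he, exp_mul_I, ofReal_cos, ofReal_sin]
  have htrig : ((Real.cos t : ℂ)) ^ 2 + (Real.sin t : ℂ) ^ 2 = 1 := by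
    exact_mod_cast Real.cos_sq_add_sin_sq t
  have hv : 1 + e ^ 2 = 2 * Real.cos t * e := by
    rw [hee]
    linear_combination -htrig + (Real.sin t : ℂ) ^ 2 * I_sq
  have hu : ν * I * (1 - e ^ 2) = 2 * (ν * Real.sin t) * e := by
    rw [hee]
    linear_combination -ν * I * htrig
      - (ν * I * (Real.sin t : ℂ) ^ 2 + 2 * ν * Real.cos t * Real.sin t) * I_sq
  have h : discResponse γ w₀ c ν (exp ((2 * t : ℝ) * I))
      = ((ν * Real.sin t * Real.cos t : ℝ) : ℂ) /
        ((((ν * Real.sin t) ^ 2 - w₀ ^ 2 * Real.cos t ^ 2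
          - c * (ν * Real.sin t * Real.cos t) : ℝ) : ℂ)
          + ((γ * (ν * Real.sin t * Real.cos t) : ℝ) : ℂ) * I) := by
    have hne : (4 * e ^ 2 : ℂ) ≠ 0 :=
      mul_ne_zero (by norm_num) (pow_ne_zero 2 (Complex.exp_ne_zero _))
    unfold discResponse
    rw [hexp, hu, hv]
    refine Eq.trans ?_ (mul_div_mul_left _ _ hne)
    push_cast
    congr 1 <;> ring
  rw [h, div_im, normSq_apply]
  simp only [mul_re, mul_im, add_re, add_im, ofReal_re, ofReal_im, I_re, I_im]
  ring_nf

/-- The residue computation converting the frequency integral of the potential energy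
into a Matsubara term: for `γ₀, ω₀, ν > 0`,
`(ω₀²/π) ∫ ω²/(ω²+ν²) Φ(ω) dω = ω₀²(ν²+ω₀²+γ₀ν)/[(ν²+ω₀²+γ₀ν)² + (νω_c)²]`,
where `Φ(ω) = γ₀/[(ω²−ω₀²−ωω_c)² + (γ₀ω)²]`. -/
theorem matsubara_residue_identity
    (γ₀ ω₀ ω_c ν : ℝ) (hγ : 0 < γ₀) (hω₀ : 0 < ω₀) (hν : 0 < ν)
    (Φ : ℝ → ℝ)
    (hΦ : ∀ ω : ℝ, Φ ω = γ₀ / ((ω ^ 2 - ω₀ ^ 2 - ω * ω_c) ^ 2 + (γ₀ * ω) ^ 2)) :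
    (ω₀ ^ 2 / π) * ∫ ω : ℝ, (ω ^ 2 / (ω ^ 2 + ν ^ 2)) * Φ ω
      = ω₀ ^ 2 * (ν ^ 2 + ω₀ ^ 2 + γ₀ * ν)
          / ((ν ^ 2 + ω₀ ^ 2 + γ₀ * ν) ^ 2 + (ν * ω_c) ^ 2) := by
  have hG := integral_im_exp_two_mul (diffContOnCl_discResponse ω_c hγ hω₀ hν)
  have h_integral : ∫ ω : ℝ, (ω ^ 2 / (ω ^ 2 + ν ^ 2)) * Φ ω
      = ∫ t in -(π / 2)..π / 2,
        -ν⁻¹ * (discResponse γ₀ ω₀ ω_c ν (Complex.exp ((2 * t : ℝ) * Complex.I))).im := by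
    rw [integral_eq_integral_mul_tan hν, intervalIntegral.integral_of_le (by linarith [pi_pos]),
      intervalIntegral.integral_of_le (by linarith [pi_pos]), integral_Ioc_eq_integral_Ioo,
      integral_Ioc_eq_integral_Ioo]
    refine setIntegral_congr_fun measurableSet_Ioo fun t ht ↦ ?_
    have hcos : cos t ≠ 0 := (cos_pos_of_mem_Ioo ht).ne'
    rw [hΦ, discResponse_exp_im, tan_eq_sin_div_cos]
    have h1 : (ν * (sin t / cos t)) ^ 2 + ν ^ 2 = ν ^ 2 / cos t ^ 2 := by
      field_simp
      linarith [sin_sq_add_cos_sq t]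
    have h2 : ((ν * (sin t / cos t)) ^ 2 - ω₀ ^ 2 - ν * (sin t / cos t) * ω_c) ^ 2
        + (γ₀ * (ν * (sin t / cos t))) ^ 2
        = (((ν * sin t) ^ 2 - ω₀ ^ 2 * cos t ^ 2 - ω_c * (ν * sin t * cos t)) ^ 2
          + (γ₀ * (ν * sin t * cos t)) ^ 2) / cos t ^ 4 := by
      field_simp
    rw [h1, h2]
    field_simp
  rw [h_integral, intervalIntegral.integral_const_mul, hG, discResponse_zero_im ω_c hγ hν]
  field_simp
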